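/- Let A ⊂ ℂⁿ be a compact set, not contained in a complex affine hyperplane, that is complex symmetric with center at the origin (ξA = A for all |ξ| = 1). Then the maximal-volume complex ellipsoid inscribed in the convex hull of A is unique. -/

import Mathlib

open MeasureTheory Pointwise

/-- A complex ellipsoid in `ℂⁿ`: image of the closed unit ball under an
invertible complex affine map. -/
def IsComplexEllipsoid (n : ℕ) (E : Set (EuclideanSpace ℂ (Fin n))) : Prop :=
  ∃ (T : EuclideanSpace ℂ (Fin n) ≃ₗ[ℂ] EuclideanSpace ℂ (Fin n))
    (v : EuclideanSpace ℂ (Fin n)),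
    E = (fun x => T x + v) '' Metric.closedBall 0 1

/-- Lebesgue volume of a subset of `ℂⁿ ≅ ℝ^{2n}`. -/
noncomputable def cVolume (n : ℕ) (S : Set (EuclideanSpace ℂ (Fin n))) : ENNReal :=
  volume ((WithLp.equiv 2 (Fin n → ℂ)) '' S)

lemma isCompact_convexHull_of_finiteDimensional {E : Type*} [NormedAddCommGroup E]
    [NormedSpace ℝ E] [FiniteDimensional ℝ E] {A : Set E} (hA : IsCompact A) :
    IsCompact (convexHull ℝ A) := by
  rcases A.eq_empty_or_nonempty with rfl | ⟨a, ha⟩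
  · simp
  let d := Module.finrank ℝ E + 1
  let f : (Fin d → ℝ) × (Fin d → E) → E := fun p => ∑ i, p.1 i • p.2 i
  have hf : Continuous f := by fun_prop
  convert ((isCompact_stdSimplex ℝ (Fin d)).prod
    (isCompact_univ_pi fun _ : Fin d => hA)).image hf using 1
  refine Set.Subset.antisymm (fun x hx => ?_) ?_
  · obtain ⟨ι, _, z, w, hz, hind, hw, hw1, rfl⟩ := eq_pos_convex_span_of_mem_convexHull hx
    have hcard : Fintype.card ι ≤ Fintype.card (Fin d) := by
      simpa [d] using hind.card_le_finrank_succ.trans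
        (Nat.add_le_add_right (Submodule.finrank_le _) 1)
    obtain ⟨e⟩ := Function.Embedding.nonempty_of_card_le hcard
    refine ⟨(Function.extend e w 0, Function.extend e z fun _ => a), ⟨⟨fun i => ?_, ?_⟩, ?_⟩, ?_⟩
    · by_cases h : ∃ j, e j = i
      · obtain ⟨j, rfl⟩ := h
        simpa [e.injective.extend_apply] using (hw j).le
      · simp [Function.extend_apply' _ _ _ h]
    · rw [← hw1]
      refine (Fintype.sum_of_injective e e.injective _ _ (fun i hi => ?_) fun i => ?_).symm
      · exact Function.extend_apply' _ _ _ hi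
      · exact (e.injective.extend_apply _ _ _).symm
    · intro i _
      by_cases h : ∃ j, e j = i
      · obtain ⟨j, rfl⟩ := h
        simpa [e.injective.extend_apply] using hz ⟨j, rfl⟩
      · simpa [Function.extend_apply' _ _ _ h] using ha
    · refine (Fintype.sum_of_injective e e.injective _ _ (fun i hi => ?_) fun i => ?_).symm
      · simp [Function.extend_apply' _ _ _ hi]
      · simp [e.injective.extend_apply]
  · rintro _ ⟨⟨w, z⟩, ⟨hw, hz⟩, rfl⟩
    exact (convex_convexHull ℝ A).sum_mem (fun i _ => hw.1 i) hw.2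
      fun i _ => subset_convexHull ℝ A (hz i trivial)

lemma Convex.add_smul_mem_of_forall_norm_eq_one {E : Type*} [AddCommGroup E] [Module ℂ E]
    {K : Set E} (hK : Convex ℝ K) {y v : E} (h : ∀ ξ : ℂ, ‖ξ‖ = 1 → y + ξ • v ∈ K)
    {c : ℂ} (hc : ‖c‖ ≤ 1) : y + c • v ∈ K := by
  obtain ⟨ξ, hξ, hcξ⟩ : ∃ ξ : ℂ, ‖ξ‖ = 1 ∧ c = (‖c‖ : ℂ) * ξ :=
    ⟨Complex.exp (c.arg * Complex.I), Complex.norm_exp_ofReal_mul_I _,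
      (Complex.norm_mul_exp_arg_mul_I c).symm⟩
  have := hK (h ξ hξ) (h (-ξ) (by simpa using hξ)) (a := (1 + ‖c‖) / 2) (b := (1 - ‖c‖) / 2)
    (by positivity) (by linarith) (by ring)
  convert this using 1
  nth_rewrite 1 [hcξ]
  rw [← Complex.coe_smul, ← Complex.coe_smul]
  push_cast
  module

lemma balanced_convexHull_of_forall_norm_eq_one {E : Type*} [AddCommGroup E]
    [Module ℂ E] {A : Set E} (hsym : ∀ ξ : ℂ, ‖ξ‖ = 1 → ξ • A = A) :
    Balanced ℂ (convexHull ℝ A) := by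
  rw [balanced_iff_smul_mem]
  intro c hc x hx
  rw [← zero_add (c • x)]
  refine (convex_convexHull ℝ A).add_smul_mem_of_forall_norm_eq_one (fun ξ hξ => ?_) hc
  have h : ξ • convexHull ℝ A = convexHull ℝ (ξ • A) :=
    (LinearMap.lsmul ℂ E ξ |>.restrictScalars ℝ).image_convexHull A
  rw [hsym ξ hξ] at h
  rw [zero_add]
  exact h ▸ Set.smul_mem_smul_set hx

lemma det_eq_prod_of_apply_basis {E : Type*} [AddCommGroup E] [Module ℂ E]
    {ι : Type*} [Fintype ι] [DecidableEq ι] (b : Module.Basis ι ℂ E)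
    {T : E →ₗ[ℂ] E} {s : ι → ℂ} (h : ∀ i, T (b i) = s i • b i) :
    LinearMap.det T = ∏ i, s i := by
  rw [← LinearMap.det_toMatrix b, ← Matrix.det_diagonal]
  congr 1
  ext i j
  rw [LinearMap.toMatrix_apply, h, Matrix.diagonal_apply]
  simp [Finsupp.single_apply, eq_comm]
  grind

section
variable {E : Type*} [NormedAddCommGroup E] [InnerProductSpace ℂ E] [FiniteDimensional ℂ E]

lemma exists_isometry_eq_smul (S : E ≃ₗ[ℂ] E) :
    ∃ (U : E ≃ₗᵢ[ℂ] E) (b : OrthonormalBasis (Fin (Module.finrank ℂ E)) ℂ E)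
      (σ : Fin (Module.finrank ℂ E) → ℝ), (∀ i, 0 < σ i) ∧ ∀ i, S (b i) = (σ i : ℂ) • U (b i) := by
  set T : E →ₗ[ℂ] E := S.toLinearMap
  have hG := T.isSymmetric_adjoint_comp_self
  set b := hG.eigenvectorBasis rfl
  have hinner : ∀ i j, inner ℂ (T (b i)) (T (b j)) =
      (hG.eigenvalues rfl j : ℂ) * inner ℂ (b i) (b j) := by
    intro i j
    rw [← LinearMap.adjoint_inner_right, ← LinearMap.comp_apply, hG.apply_eigenvectorBasis,
      inner_smul_right]
    rfl
  have hnorm : ∀ i, ‖T (b i)‖ ^ 2 = hG.eigenvalues rfl i := by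
    intro i
    have := hinner i i
    rw [inner_self_eq_norm_sq_to_K, inner_self_eq_norm_sq_to_K, b.norm_eq_one] at this
    simpa [← Complex.ofReal_pow] using congrArg Complex.re this
  have hpos : ∀ i, 0 < ‖T (b i)‖ := fun i => by
    rw [norm_pos_iff]
    exact S.map_ne_zero_iff.mpr (b.orthonormal.ne_zero i)
  have hon : Orthonormal ℂ fun i => ((‖T (b i)‖ : ℂ)⁻¹) • T (b i) := by
    refine ⟨fun i => ?_, fun i j hij => ?_⟩
    · simp [norm_smul, (hpos i).ne']
    · change inner ℂ _ _ = _
      rw [inner_smul_left, inner_smul_right, hinner, b.orthonormal.2 hij]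
      simp
  let c := OrthonormalBasis.mk hon
    (hon.linearIndependent.span_eq_top_of_card_eq_finrank' (by simp)).ge
  refine ⟨b.equiv c (Equiv.refl _), b, fun i => ‖T (b i)‖, hpos, fun i => ?_⟩
  have : (‖T (b i)‖ : ℂ) ≠ 0 := by exact_mod_cast (hpos i).ne'
  simp only [c, OrthonormalBasis.equiv_apply_basis, Equiv.refl_apply, OrthonormalBasis.coe_mk,
    smul_smul, mul_inv_cancel₀ this, one_smul]
  rfl

end

lemma eq_one_of_prod_add_one_half_le_one {ι : Type*} [Fintype ι] {σ : ι → ℝ} (hσ : ∀ i, 0 < σ i)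
    (h1 : ∏ i, σ i = 1) (h : ∏ i, (1 + σ i) / 2 ≤ 1) (i : ι) : σ i = 1 := by
  have hle : ∀ i, σ i ≤ ((1 + σ i) / 2) ^ 2 := fun i => by nlinarith [sq_nonneg (σ i - 1)]
  by_contra hi
  have : ∏ i, σ i < ∏ i, ((1 + σ i) / 2) ^ 2 :=
    Finset.prod_lt_prod (fun i _ => hσ i) (fun i _ => hle i)
      ⟨i, Finset.mem_univ i, by nlinarith [sq_pos_of_ne_zero (sub_ne_zero.mpr hi)]⟩
  rw [h1, Finset.prod_pow] at this
  exact this.not_ge (pow_le_one₀ (Finset.prod_nonneg fun i _ => by linarith [hσ i]) h)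

section
variable {E : Type*} [NormedAddCommGroup E] [NormedSpace ℂ E]

lemma Convex.map_add_smul_mem_of_balanced {K : Set E} (hK : Convex ℝ K) (hbal : Balanced ℂ K)
    {T : E →ₗ[ℂ] E} {v : E} (h : ∀ x, ‖x‖ ≤ 1 → T x + v ∈ K) {x : E} (hx : ‖x‖ ≤ 1)
    {c : ℂ} (hc : ‖c‖ ≤ 1) : T x + c • v ∈ K := by
  refine hK.add_smul_mem_of_forall_norm_eq_one (fun ξ hξ => ?_) hc
  have hξ0 : ξ ≠ 0 := norm_ne_zero_iff.mp (by simp [hξ])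
  have := hbal.smul_mem hξ.le (h (ξ⁻¹ • x) (by simpa [norm_smul, hξ] using hx))
  simpa [smul_smul, hξ0] using this

lemma exists_equiv_forall_norm_le_mem_of_span_eq_top [FiniteDimensional ℂ E] {ι : Type*} [Fintype ι]
    (e : Module.Basis ι ℂ E) (he : ∀ x, ‖x‖ ≤ 1 → ∀ i, ‖e.repr x i‖ ≤ 1)
    {K : Set E} (hK : Convex ℝ K) (hbal : Balanced ℂ K) (hne : K.Nonempty)
    (hspan : Submodule.span ℂ K = ⊤) :
    ∃ T : E ≃ₗ[ℂ] E, ∀ x, ‖x‖ ≤ 1 → T x ∈ K := by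
  rcases isEmpty_or_nonempty ι with hι | hι
  · have : Subsingleton E := e.repr.toEquiv.subsingleton
    obtain ⟨k, hk⟩ := hne
    exact ⟨LinearEquiv.refl ℂ E, fun x _ => Subsingleton.elim k x ▸ hk⟩
  let b := Module.Basis.ofSpan hspan.ge
  let a := b.reindex (b.indexEquiv e)
  have ha : ∀ i, a i ∈ K := fun i =>
    Module.Basis.ofSpan_subset hspan.ge (by simp [a, b])
  have hN : (Fintype.card ι : ℂ) ≠ 0 := by exact_mod_cast Fintype.card_ne_zero
  refine ⟨(e.equiv a (Equiv.refl ι)).trans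
    (LinearEquiv.smulOfNeZero ℂ E (Fintype.card ι : ℂ)⁻¹ (inv_ne_zero hN)), fun x hx => ?_⟩
  have hsum := hK.sum_mem (t := Finset.univ) (w := fun _ : ι => (Fintype.card ι : ℝ)⁻¹)
    (z := fun i => e.repr x i • a i) (fun _ _ => by positivity)
    (by simp) (fun i _ => hbal.smul_mem (he x hx i) (ha i))
  convert hsum using 1
  have : e.equiv a (Equiv.refl ι) x = ∑ i, e.repr x i • a i := by
    conv_lhs => rw [← e.sum_repr x, map_sum]
    exact Finset.sum_congr rfl fun i _ => by simp
  simp only [LinearEquiv.trans_apply, LinearEquiv.smulOfNeZero_apply, this, Finset.smul_sum,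
    ← Complex.coe_smul]
  simp

lemma exists_isMaxOn_norm_det [FiniteDimensional ℂ E] {K : Set E} (hK : IsCompact K)
    (h0 : (0 : E) ∈ K) :
    ∃ T : E →ₗ[ℂ] E, (∀ x, ‖x‖ ≤ 1 → T x ∈ K) ∧
      ∀ S : E →ₗ[ℂ] E, (∀ x, ‖x‖ ≤ 1 → S x ∈ K) → ‖LinearMap.det S‖ ≤ ‖LinearMap.det T‖ := by
  have : ProperSpace (E →L[ℂ] E) := FiniteDimensional.proper ℂ _
  let C : Set (E →L[ℂ] E) := {T | ∀ x, ‖x‖ ≤ 1 → T x ∈ K}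
  have hclosed : IsClosed C := by
    simp only [C, Set.ofPred_forall]
    exact isClosed_iInter fun x => isClosed_iInter fun _ =>
      hK.isClosed.preimage (ContinuousLinearMap.apply ℂ E x).continuous
  obtain ⟨R, hR⟩ := hK.isBounded.exists_norm_le
  have hbdd : Bornology.IsBounded C := by
    refine isBounded_iff_forall_norm_le.mpr ⟨R, fun T hT => ?_⟩
    refine T.opNorm_le_of_unit_norm ((norm_nonneg _).trans (hR 0 h0)) fun x hx => ?_
    exact hR _ (hT x hx.le)
  obtain ⟨T, hT, hmax⟩ := (Metric.isCompact_of_isClosed_isBounded hclosed hbdd).exists_isMaxOn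
    ⟨0, fun x _ => by simpa using h0⟩
    (ContinuousLinearMap.continuous_det (𝕜 := ℂ) (E := E)).norm.continuousOn
  exact ⟨T, hT, fun S hS => hmax (show LinearMap.toContinuousLinearMap S ∈ C from hS)⟩

end

section
variable {E : Type*} [NormedAddCommGroup E] [InnerProductSpace ℂ E] [FiniteDimensional ℂ E]

lemma eq_zero_of_forall_norm_det_le {K : Set E} (hK : Convex ℝ K) (hbal : Balanced ℂ K)
    {T : E ≃ₗ[ℂ] E} {v : E} (h : ∀ x, ‖x‖ ≤ 1 → T x + v ∈ K)
    (hmax : ∀ S : E →ₗ[ℂ] E, (∀ x, ‖x‖ ≤ 1 → S x ∈ K) →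
      ‖LinearMap.det S‖ ≤ ‖LinearMap.det (T : E →ₗ[ℂ] E)‖) : v = 0 := by
  by_contra hv
  set w := T.symm v
  have hw : w ≠ 0 := by simpa [w] using hv
  have hw' : 0 < ‖w‖ := norm_pos_iff.mpr hw
  set u : E := (‖w‖ : ℂ)⁻¹ • w
  have hu : ‖u‖ = 1 := by simp [u, norm_smul, hw'.ne']
  let f : Module.Dual ℂ E := (innerSL ℂ u).toLinearMap
  have hfw : f w = ‖w‖ := by
    have : (‖w‖ : ℂ) ≠ 0 := by exact_mod_cast hw'.ne'
    simp only [f, u, ContinuousLinearMap.coe_coe, innerSL_apply_apply, inner_smul_left,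
      inner_self_eq_norm_sq_to_K]
    simp
    field_simp
  have hle := hmax (T.toLinearMap ∘ₗ LinearMap.transvection f w) fun x hx => by
    have hc : ‖f x‖ ≤ 1 := (norm_inner_le_norm u x).trans (by rw [hu, one_mul]; exact hx)
    have := hK.map_add_smul_mem_of_balanced hbal (T := T.toLinearMap) h hx hc
    simpa [LinearMap.transvection.apply, w] using this
  have hT : 0 < ‖LinearMap.det (T : E →ₗ[ℂ] E)‖ :=
    norm_pos_iff.mpr (LinearEquiv.isUnit_det' T).ne_zero
  rw [LinearMap.det_comp, LinearMap.transvection.det, hfw, norm_mul] at hle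
  have h1 : ‖(1 : ℂ) + ‖w‖‖ = 1 + ‖w‖ := by
    rw [← Complex.ofReal_one, ← Complex.ofReal_add, Complex.norm_real,
      Real.norm_of_nonneg (by positivity)]
  rw [h1] at hle
  nlinarith

lemma image_closedBall_eq_of_forall_norm_det_le {K : Set E} (hK : Convex ℝ K)
    {T₁ T₂ : E ≃ₗ[ℂ] E} (h₁ : ∀ x, ‖x‖ ≤ 1 → T₁ x ∈ K) (h₂ : ∀ x, ‖x‖ ≤ 1 → T₂ x ∈ K)
    (hdet : ‖LinearMap.det (T₂ : E →ₗ[ℂ] E)‖ = ‖LinearMap.det (T₁ : E →ₗ[ℂ] E)‖)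
    (hmax : ∀ S : E →ₗ[ℂ] E, (∀ x, ‖x‖ ≤ 1 → S x ∈ K) →
      ‖LinearMap.det S‖ ≤ ‖LinearMap.det (T₁ : E →ₗ[ℂ] E)‖) :
    T₂ '' Metric.closedBall 0 1 = T₁ '' Metric.closedBall 0 1 := by
  obtain ⟨U, b, σ, hσ, hS⟩ := exists_isometry_eq_smul (T₂.trans T₁.symm)
  have hS' : ∀ i, T₂ (b i) = (σ i : ℂ) • T₁ (U (b i)) := fun i => by
    rw [← map_smul, ← hS]; simp
  have hdiag : ∀ (S : E →ₗ[ℂ] E) (s : Fin (Module.finrank ℂ E) → ℝ), (∀ i, 0 < s i) →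
      (∀ i, S (b i) = (s i : ℂ) • T₁ (U (b i))) →
      ‖LinearMap.det S‖ = ‖LinearMap.det (T₁ : E →ₗ[ℂ] E)‖ * ∏ i, s i := by
    intro S s hs hSb
    set V : E ≃ₗ[ℂ] E := U.toLinearEquiv.trans T₁
    have hV : ‖LinearMap.det (V : E →ₗ[ℂ] E)‖ = ‖LinearMap.det (T₁ : E →ₗ[ℂ] E)‖ := by
      have : LinearMap.det (V : E →ₗ[ℂ] E) = LinearMap.det (T₁ : E →ₗ[ℂ] E) *
          LinearMap.det (U.toLinearEquiv : E →ₗ[ℂ] E) := by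
        rw [← LinearMap.det_comp]; rfl
      have hU : ‖LinearMap.det (U.toLinearEquiv : E →ₗ[ℂ] E)‖ = 1 := by
        rw [← LinearMap.normDet_eq_norm_det]
        exact U.toLinearIsometry.normDet_eq_one
      rw [this, norm_mul, hU, mul_one]
    have hD := det_eq_prod_of_apply_basis b.toBasis (T := V.symm.toLinearMap ∘ₗ S)
      (s := fun i => (s i : ℂ)) fun i => by
        simp [hSb, V, -Complex.coe_smul]
    have hSV : S = V.toLinearMap ∘ₗ (V.symm.toLinearMap ∘ₗ S) := by
      ext x; simp
    rw [hSV, LinearMap.det_comp, hD, norm_mul, hV, norm_prod]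
    congr 1
    exact Finset.prod_congr rfl fun i _ => by
      rw [Complex.norm_real, Real.norm_of_nonneg (hs i).le]
  have hT : 0 < ‖LinearMap.det (T₁ : E →ₗ[ℂ] E)‖ :=
    norm_pos_iff.mpr (LinearEquiv.isUnit_det' T₁).ne_zero
  have hprod : ∏ i, σ i = 1 := by
    have := hdiag T₂ σ hσ hS'
    rw [hdet] at this
    exact mul_left_cancel₀ hT.ne' (by rw [← this, mul_one])
  let M : E →ₗ[ℂ] E :=
    (2⁻¹ : ℂ) • (T₁.toLinearMap ∘ₗ U.toLinearEquiv.toLinearMap + T₂.toLinearMap)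
  have hM : ∀ x, ‖x‖ ≤ 1 → M x ∈ K := fun x hx => by
    have := hK (h₁ (U x) (by simpa using hx)) (h₂ x hx) (a := 2⁻¹) (b := 2⁻¹)
      (by norm_num) (by norm_num) (by norm_num)
    convert this using 1
    rw [← Complex.coe_smul, ← Complex.coe_smul]
    simp [M]
  have hMdet := hdiag M (fun i => (1 + σ i) / 2) (fun i => by linarith [hσ i]) fun i => by
    simp only [M, LinearMap.smul_apply, LinearMap.add_apply, LinearMap.comp_apply,
      LinearEquiv.coe_coe, hS']
    push_cast
    rw [show U.toLinearEquiv (b i) = U (b i) from rfl]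
    module
  have hle : ∏ i, (1 + σ i) / 2 ≤ 1 := by
    have := hmax M hM
    rw [hMdet] at this
    exact le_of_mul_le_mul_left (by simpa using this) hT
  have hone := eq_one_of_prod_add_one_half_le_one hσ hprod hle
  have hcomp : T₂ = U.toLinearEquiv.trans T₁ := by
    refine LinearEquiv.toLinearMap_injective (b.toBasis.ext fun i => ?_)
    simp [hS', hone]
  have himg : (T₂ : E → E) = T₁ ∘ U := by rw [hcomp]; rfl
  rw [himg, Set.image_comp, U.image_closedBall, map_zero]

end

lemma cVolume_image_add (n : ℕ) (T : EuclideanSpace ℂ (Fin n) →ₗ[ℂ] EuclideanSpace ℂ (Fin n))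
    (v : EuclideanSpace ℂ (Fin n)) (S : Set (EuclideanSpace ℂ (Fin n))) :
    cVolume n ((fun x => T x + v) '' S) =
      ENNReal.ofReal (‖LinearMap.det T‖ ^ 2) * cVolume n S := by
  let e : EuclideanSpace ℂ (Fin n) ≃ₗ[ℂ] (Fin n → ℂ) := WithLp.linearEquiv 2 ℂ (Fin n → ℂ)
  let T' : (Fin n → ℂ) →ₗ[ℂ] (Fin n → ℂ) := e.toLinearMap ∘ₗ T ∘ₗ e.symm.toLinearMap
  have himg : (WithLp.equiv 2 (Fin n → ℂ)) '' ((fun x => T x + v) '' S) =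
      (fun y => y + e v) '' ((T'.restrictScalars ℝ) '' ((WithLp.equiv 2 (Fin n → ℂ)) '' S)) := by
    simp only [Set.image_image]
    rfl
  have hdet : |LinearMap.det (T'.restrictScalars ℝ)| = ‖LinearMap.det T‖ ^ 2 := by
    rw [LinearMap.det_restrictScalars, Algebra.norm_complex_apply, LinearMap.det_conj,
      Complex.normSq_eq_norm_sq, abs_of_nonneg (by positivity)]
  rw [cVolume, himg, Set.image_add_right, measure_preimage_add_right,
    Measure.addHaar_image_linearMap, hdet, cVolume]

lemma cVolume_closedBall_ne_zero (n : ℕ) :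
    cVolume n (Metric.closedBall 0 1) ≠ 0 := by
  let e := PiLp.homeomorph 2 (fun _ : Fin n => ℂ)
  have h : IsOpen (e '' Metric.ball 0 1) := e.isOpenMap _ Metric.isOpen_ball
  refine (lt_of_lt_of_le (h.measure_pos volume ((Metric.nonempty_ball.mpr one_pos).image _))
    (measure_mono (Set.image_mono Metric.ball_subset_closedBall))).ne'

lemma cVolume_closedBall_ne_top (n : ℕ) :
    cVolume n (Metric.closedBall 0 1) ≠ ⊤ :=
  ((isCompact_closedBall _ _).image
    (PiLp.homeomorph 2 (fun _ : Fin n => ℂ)).continuous).measure_ne_top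

lemma cVolume_ellipsoid_le_iff {n : ℕ}
    {T₁ T₂ : EuclideanSpace ℂ (Fin n) →ₗ[ℂ] EuclideanSpace ℂ (Fin n)}
    {v₁ v₂ : EuclideanSpace ℂ (Fin n)} :
    cVolume n ((fun x => T₁ x + v₁) '' Metric.closedBall 0 1) ≤
        cVolume n ((fun x => T₂ x + v₂) '' Metric.closedBall 0 1) ↔
      ‖LinearMap.det T₁‖ ≤ ‖LinearMap.det T₂‖ := by
  rw [cVolume_image_add, cVolume_image_add, ENNReal.mul_le_mul_iff_left
    (cVolume_closedBall_ne_zero n) (cVolume_closedBall_ne_top n),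
    ENNReal.ofReal_le_ofReal_iff (by positivity), sq_le_sq₀ (by positivity) (by positivity)]

/-- If `A ⊂ ℂⁿ` is compact, non-flat and complex symmetric with center the
origin, then the maximal-volume complex ellipsoid inscribed in the convex hull
of `A` is unique. -/
theorem unique_maximal_inscribed_ellipsoid_of_symmetric (n : ℕ)
    (A : Set (EuclideanSpace ℂ (Fin n))) (hA : IsCompact A)
    (hflat : affineSpan ℂ A = ⊤)
    (hsym : ∀ ξ : ℂ, ‖ξ‖ = 1 → ξ • A = A) :
    ∃! E : Set (EuclideanSpace ℂ (Fin n)),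
      IsComplexEllipsoid n E ∧ E ⊆ convexHull ℝ A ∧
        ∀ E', IsComplexEllipsoid n E' → E' ⊆ convexHull ℝ A →
          cVolume n E' ≤ cVolume n E := by
  have hK := convex_convexHull ℝ A
  have hbal := balanced_convexHull_of_forall_norm_eq_one hsym
  have : FiniteDimensional ℝ (EuclideanSpace ℂ (Fin n)) := FiniteDimensional.complexToReal _
  have hcomp := isCompact_convexHull_of_finiteDimensional hA
  have hAne : A.Nonempty := (AffineSubspace.nonempty_of_affineSpan_eq_top ℂ _ _ hflat)
  have hne : (convexHull ℝ A).Nonempty := hAne.convexHull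
  have hspan : Submodule.span ℂ (convexHull ℝ A) = ⊤ := by
    rw [eq_top_iff]
    intro x _
    have hx : x ∈ affineSpan ℂ A := hflat ▸ AffineSubspace.mem_top ℂ _ x
    exact Submodule.span_mono (subset_convexHull ℝ A) (affineSpan_le_toAffineSubspace_span hx)
  set K := convexHull ℝ A
  obtain ⟨T, hT, hmax⟩ := exists_isMaxOn_norm_det hcomp (hbal.zero_mem hne)
  obtain ⟨T₀, hT₀⟩ := exists_equiv_forall_norm_le_mem_of_span_eq_top
    (EuclideanSpace.basisFun (Fin n) ℂ).toBasis
    (fun x hx i => by simpa using (PiLp.norm_apply_le x i).trans hx) hK hbal hne hspan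
  have hdetT : LinearMap.det T ≠ 0 := norm_pos_iff.mp <|
    (norm_pos_iff.mpr (LinearEquiv.isUnit_det' T₀).ne_zero).trans_le (hmax T₀ hT₀)
  obtain ⟨T, rfl⟩ : ∃ T' : EuclideanSpace ℂ (Fin n) ≃ₗ[ℂ] EuclideanSpace ℂ (Fin n),
      (T' : EuclideanSpace ℂ (Fin n) →ₗ[ℂ] EuclideanSpace ℂ (Fin n)) = T :=
    ⟨T.equivOfDetNeZero hdetT, LinearEquiv.coe_ofIsUnitDet _⟩
  have hcenter : ∀ {S : EuclideanSpace ℂ (Fin n) ≃ₗ[ℂ] EuclideanSpace ℂ (Fin n)}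
      {v : EuclideanSpace ℂ (Fin n)}, (fun x => S x + v) '' Metric.closedBall 0 1 ⊆ K →
      (∀ x, ‖x‖ ≤ 1 → S x + v ∈ K) ∧ ∀ x, ‖x‖ ≤ 1 → S x ∈ K := by
    intro S v h
    have h' : ∀ x, ‖x‖ ≤ 1 → S x + v ∈ K := fun x hx => h ⟨x, by simpa using hx, rfl⟩
    refine ⟨h', fun x hx => ?_⟩
    simpa using hK.map_add_smul_mem_of_balanced hbal (T := S.toLinearMap) h' hx
      (c := 0) (by simp)
  have hvol : ∀ (S : EuclideanSpace ℂ (Fin n) ≃ₗ[ℂ] EuclideanSpace ℂ (Fin n))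
      (v : EuclideanSpace ℂ (Fin n)), (fun x => S x + v) '' Metric.closedBall 0 1 ⊆ K →
      cVolume n ((fun x => S x + v) '' Metric.closedBall 0 1) ≤
        cVolume n ((fun x => T x + 0) '' Metric.closedBall 0 1) := fun S v h =>
    cVolume_ellipsoid_le_iff.mpr (hmax S (hcenter h).2)
  have hTK : (fun x => T x + 0) '' Metric.closedBall 0 1 ⊆ K := by
    rintro _ ⟨x, hx, rfl⟩
    simpa using hT x (by simpa using hx)
  refine ⟨(fun x => T x + 0) '' Metric.closedBall 0 1, ⟨⟨T, 0, rfl⟩, hTK, ?_⟩, ?_⟩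
  · rintro _ ⟨S, v, rfl⟩ h
    exact hvol S v h
  · rintro _ ⟨⟨S, v, rfl⟩, h, hS⟩
    have hdet := (hmax S (hcenter h).2).antisymm
      (cVolume_ellipsoid_le_iff.mp (hS _ ⟨T, 0, rfl⟩ hTK))
    obtain rfl : v = 0 := eq_zero_of_forall_norm_det_le hK hbal (hcenter h).1
      fun S' hS' => (hmax S' hS').trans hdet.ge
    simpa using image_closedBall_eq_of_forall_norm_det_le hK hT (hcenter h).2 hdet hmax
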